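/- For every vector v ∈ V ⊗ V one has (1 − C_q)v = 0 if and only if (1 + P_q)v = 0 and Q_q v = 0; dually, for every linear functional w on V ⊗ V one has w ∘ (1 − C_q) = 0 if and only if w ∘ (1 + P_q) = 0 and w ∘ Q_q = 0. (Hence the defining relations of the quadratic algebras Ξ_{C_q}(K) and Ξ*_{C_q}(K) split into a q-Grassmann part and one symplectic relation.) -/

import Mathlib

open scoped BigOperators

noncomputable section

/-- The index set `I = {-r, …, -1, 1, …, r}` as a subtype of `ℤ`. -/
abbrev SIdx (r : ℕ) : Type := {i : ℤ // i ∈ (Finset.Icc (-(r : ℤ)) (r : ℤ)).erase 0}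

instance (r : ℕ) : Neg (SIdx r) :=
  ⟨fun i => ⟨-i.1, by
    obtain ⟨h1, h2⟩ := Finset.mem_erase.mp i.2
    rw [Finset.mem_Icc] at h2
    exact Finset.mem_erase.mpr ⟨neg_ne_zero.mpr h1, Finset.mem_Icc.mpr (by omega)⟩⟩⟩

/-- The sign `ε_i`: `1` for `i > 0` and `-1` for `i < 0`, as an element of `K`. -/
def sgn (K : Type*) [Field K] {r : ℕ} (i : SIdx r) : K := if 0 < i.1 then 1 else -1

/-- A symplectic parameter family `q = (q_{ij}, q_i)`: nonzero scalars with
`q_{ij} = q_{ji}⁻¹`, `q_{ii} = 1`, `q_{-i} = q_i⁻¹` and `q_{-i,j} = q_{ij}⁻¹ q_j²`. -/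
structure SympParam (K : Type*) [Field K] (r : ℕ) where
  qm : SIdx r → SIdx r → K
  qv : SIdx r → K
  qm_ne : ∀ i j, qm i j ≠ 0
  qv_ne : ∀ i, qv i ≠ 0
  qm_symm : ∀ i j, qm i j = (qm j i)⁻¹
  qm_diag : ∀ i, qm i i = 1
  qv_neg : ∀ i, qv (-i) = (qv i)⁻¹
  qm_neg : ∀ i j, qm (-i) j = (qm i j)⁻¹ * (qv j) ^ 2

variable {K : Type*} [Field K] [CharZero K] {r : ℕ}

/-- The operator `P_q` on `V ⊗ V`, where `V = SIdx r → K` and `V ⊗ V` is realized as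
`(SIdx r × SIdx r) → K` with basis vector `e l ⊗ e m = Pi.single (l, m) 1`.  It sends
`e l ⊗ e m ↦ q_{lm} • (e m ⊗ e l)`. -/
def Pq (q : SympParam K r) : Module.End K (SIdx r × SIdx r → K) where
  toFun f := fun p => q.qm p.2 p.1 * f (p.2, p.1)
  map_add' f g := by funext p; simp [mul_add]
  map_smul' c f := by funext p; simp [smul_eq_mul]; ring

/-- The operator `Q_q` on `V ⊗ V`: it sends
`e l ⊗ e m ↦ δ_{m,-l} ε_l q_l⁻¹ • ∑ i, ε_i q_i • (e i ⊗ e (-i))`. -/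
def Qq (q : SympParam K r) : Module.End K (SIdx r × SIdx r → K) where
  toFun f := fun p =>
    if p.2 = -p.1 then
      sgn K p.1 * q.qv p.1 * ∑ l : SIdx r, sgn K l * (q.qv l)⁻¹ * f (l, -l)
    else 0
  map_add' f g := by
    funext p
    by_cases h : p.2 = -p.1 <;> simp [h, mul_add, Finset.sum_add_distrib]
  map_smul' c f := by
    funext p
    by_cases h : p.2 = -p.1 <;>
      simp only [h, if_true, if_false, Pi.smul_apply, smul_eq_mul, RingHom.id_apply,
        Finset.mul_sum, mul_zero]
    · exact Finset.sum_congr rfl fun l _ => by ring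

/-- The idempotent `C_q = (1 − P_q)/2 − Q_q/(2r)` on `V ⊗ V`. -/
def Cq (q : SympParam K r) : Module.End K (SIdx r × SIdx r → K) :=
  (2 : K)⁻¹ • (1 - Pq q) - (2 * (r : K))⁻¹ • Qq q

namespace SIdx

instance : InvolutiveNeg (SIdx r) where
  neg_neg i := Subtype.ext (neg_neg i.1)

theorem card : Fintype.card (SIdx r) = 2 * r := by
  rw [Fintype.card_coe, Finset.card_erase_of_mem (by simp), Int.card_Icc]
  omega

end SIdx

theorem sgn_neg {F : Type*} [Field F] {r : ℕ} (i : SIdx r) : sgn F (-i) = -sgn F i := by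
  have h0 : i.1 ≠ 0 := (Finset.mem_erase.mp i.2).1
  have hneg : (-i).1 = -i.1 := rfl
  unfold sgn
  rw [hneg]
  rcases lt_or_gt_of_ne h0 with h | h
  · rw [if_pos (by omega), if_neg (by omega), neg_neg]
  · rw [if_neg (by omega), if_pos h]

theorem sgn_mul_self {F : Type*} [Field F] {r : ℕ} (i : SIdx r) : sgn F i * sgn F i = 1 := by
  unfold sgn
  split_ifs <;> simp

theorem SympParam.qm_neg_self {F : Type*} [Field F] {r : ℕ} (q : SympParam F r)
    (i : SIdx r) : q.qm (-i) i = q.qv i ^ 2 := by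
  rw [q.qm_neg, q.qm_diag, inv_one, one_mul]

theorem Pq_apply {F : Type*} [Field F] {r : ℕ} (q : SympParam F r)
    (f : SIdx r × SIdx r → F) (p : SIdx r × SIdx r) :
    Pq q f p = q.qm p.2 p.1 * f (p.2, p.1) := rfl

theorem Qq_apply (q : SympParam K r) (f : SIdx r × SIdx r → K) (p : SIdx r × SIdx r) :
    Qq q f p = if p.2 = -p.1 then
      sgn K p.1 * q.qv p.1 * ∑ l : SIdx r, sgn K l * (q.qv l)⁻¹ * f (l, -l) else 0 := rfl

theorem Pq_mul_Qq (q : SympParam K r) : Pq q * Qq q = -Qq q := by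
  refine LinearMap.ext fun f => funext fun p => ?_
  obtain ⟨i, j⟩ := p
  simp only [Module.End.mul_apply, LinearMap.neg_apply, Pi.neg_apply, Pq_apply, Qq_apply]
  by_cases h : j = -i
  · subst h
    have := q.qv_ne i
    rw [if_pos (neg_neg i).symm, if_pos rfl, q.qm_neg_self, sgn_neg, q.qv_neg]
    field_simp
  · rw [if_neg fun h' => h (by rw [h', neg_neg]), if_neg h, mul_zero, neg_zero]

theorem Qq_mul_Pq (q : SympParam K r) : Qq q * Pq q = -Qq q := by
  refine LinearMap.ext fun f => funext fun p => ?_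
  have hsum : ∑ l : SIdx r, sgn K l * (q.qv l)⁻¹ * (q.qm (-l) l * f (-l, l)) =
      -∑ l : SIdx r, sgn K l * (q.qv l)⁻¹ * f (l, -l) := by
    rw [← Equiv.sum_comp (Equiv.neg (SIdx r)), ← Finset.sum_neg_distrib]
    refine Finset.sum_congr rfl fun l _ => ?_
    have := q.qv_ne l
    rw [Equiv.neg_apply, q.qm_neg_self, sgn_neg, q.qv_neg, neg_neg]
    field_simp
  simp only [Module.End.mul_apply, LinearMap.neg_apply, Pi.neg_apply, Pq_apply, Qq_apply, hsum]
  split_ifs <;> simp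

theorem Qq_mul_Qq (q : SympParam K r) : Qq q * Qq q = (2 * (r : K)) • Qq q := by
  refine LinearMap.ext fun f => funext fun p => ?_
  have hsum (S : K) : ∑ l : SIdx r, sgn K l * (q.qv l)⁻¹ * (sgn K l * q.qv l * S) =
      2 * (r : K) * S := by
    have hterm (l : SIdx r) : sgn K l * (q.qv l)⁻¹ * (sgn K l * q.qv l * S) = S := by
      have := q.qv_ne l
      calc _ = sgn K l * sgn K l * S := by field_simp
        _ = S := by rw [sgn_mul_self, one_mul]
    simp only [hterm, Finset.sum_const, Finset.card_univ, SIdx.card, nsmul_eq_mul]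
    push_cast
    ring
  simp only [Module.End.mul_apply, LinearMap.smul_apply, Pi.smul_apply, smul_eq_mul, Qq_apply,
    if_true, hsum]
  split_ifs <;> ring

theorem one_sub_Cq (q : SympParam K r) :
    1 - Cq q = (2 : K)⁻¹ • (1 + Pq q) + (2 * (r : K))⁻¹ • Qq q := by
  unfold Cq
  module

theorem Qq_mul_one_sub_Cq (hr : 1 ≤ r) (q : SympParam K r) : Qq q * (1 - Cq q) = Qq q := by
  have hr' : (2 * (r : K)) ≠ 0 := by simp; omega
  rw [one_sub_Cq, mul_add, mul_smul_comm, mul_smul_comm, mul_add, mul_one, Qq_mul_Pq,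
    Qq_mul_Qq, inv_smul_smul₀ hr', add_neg_cancel, smul_zero, zero_add]

theorem one_sub_Cq_mul_Qq (hr : 1 ≤ r) (q : SympParam K r) : (1 - Cq q) * Qq q = Qq q := by
  have hr' : (2 * (r : K)) ≠ 0 := by simp; omega
  rw [one_sub_Cq, add_mul, smul_mul_assoc, smul_mul_assoc, add_mul, one_mul, Pq_mul_Qq,
    Qq_mul_Qq, inv_smul_smul₀ hr', add_neg_cancel, smul_zero, zero_add]

/-- for `v ∈ V ⊗ V`: `(1 − C_q)v = 0 ↔ (1 + P_q)v = 0 ∧ Q_q v = 0`; dually,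
for a linear functional `w` on `V ⊗ V`:
`w ∘ (1 − C_q) = 0 ↔ w ∘ (1 + P_q) = 0 ∧ w ∘ Q_q = 0`. -/
theorem Cq_relations_split (hr : 1 ≤ r) (q : SympParam K r) :
    (∀ v : SIdx r × SIdx r → K,
      ((1 - Cq q) v = 0 ↔ (1 + Pq q) v = 0 ∧ Qq q v = 0)) ∧
    (∀ w : (SIdx r × SIdx r → K) →ₗ[K] K,
      (w ∘ₗ (1 - Cq q) = 0 ↔ w ∘ₗ (1 + Pq q) = 0 ∧ w ∘ₗ Qq q = 0)) := by
  constructor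
  · intro v
    constructor
    · intro h
      have hQ : Qq q v = 0 := by
        rw [← Qq_mul_one_sub_Cq hr q, Module.End.mul_apply, h, map_zero]
      refine ⟨?_, hQ⟩
      rw [one_sub_Cq, LinearMap.add_apply, LinearMap.smul_apply, LinearMap.smul_apply, hQ,
        smul_zero, add_zero] at h
      exact (smul_eq_zero.mp h).resolve_left (by simp)
    · rintro ⟨hP, hQ⟩
      rw [one_sub_Cq, LinearMap.add_apply, LinearMap.smul_apply, LinearMap.smul_apply, hP, hQ,
        smul_zero, smul_zero, add_zero]
  · intro w
    constructor
    · intro h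
      have hQ : w ∘ₗ Qq q = 0 := by
        rw [← one_sub_Cq_mul_Qq hr q, Module.End.mul_eq_comp, ← LinearMap.comp_assoc, h,
          LinearMap.zero_comp]
      refine ⟨?_, hQ⟩
      rw [one_sub_Cq, LinearMap.comp_add, LinearMap.comp_smul, LinearMap.comp_smul, hQ,
        smul_zero, add_zero] at h
      exact (smul_eq_zero.mp h).resolve_left (by simp)
    · rintro ⟨hP, hQ⟩
      rw [one_sub_Cq, LinearMap.comp_add, LinearMap.comp_smul, LinearMap.comp_smul, hP, hQ,
        smul_zero, smul_zero, add_zero]
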